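/- Fix ε > 0, let π0 := 1 − e^{−ε}, n0 := k_max/(1 − e^{−ε}), and Ω' := {s ∈ Ω : π(s) ≥ π0}. If the number of distinct stream items satisfies n > n0, then for every subset T ⊆ Ω both Pr(S_n ∈ T) ≤ e^{ε} · Pr(S_{n−1} ∈ T) + δ and Pr(S_{n−1} ∈ T) ≤ e^{ε} · Pr(S_n ∈ T) + δ hold, where δ := max( Pr(S_n ∈ Ω'), Pr(S_{n−1} ∈ Ω') ); that is, the unmodified sketch is (ε, δ)-differentially private with δ equal to the probability that the final sketch state is privacy-violating. -/

import Mathlib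

open MeasureTheory

attribute [local instance] Classical.propDecidable

/-- The set of hash values realized by a stream of `n` i.i.d. draws. -/
noncomputable def Afull {H : Type*} {n : ℕ} (ω : Fin n → H) : Finset H :=
  Finset.image ω Finset.univ

/-- The set of hash values realized by the stream with the `i`-th item removed. -/
noncomputable def Aerase {H : Type*} {n : ℕ} (i : Fin n) (ω : Fin n → H) : Finset H :=
  Finset.image ω (Finset.univ.erase i)

/-- The (random) set of indices whose removal changes the sketch. -/
noncomputable def Kset {H : Type*} {Ω : Type*} (f : Finset H → Ω) {n : ℕ}
    (ω : Fin n → H) : Finset (Fin n) :=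
  Finset.univ.filter fun i => f (Aerase i ω) ≠ f (Afull ω)

/-- The law of a stream of `n` i.i.d. hash values, each with law `μ`. -/
noncomputable def streamP {H : Type*} [MeasurableSpace H] (μ : Measure H) (n : ℕ) :
    Measure (Fin n → H) :=
  Measure.pi fun _ => μ

/-!
STATEMENT 6: Fix `ε > 0`, `π0 := 1 - e^{-ε}`, `n0 := k_max/(1 - e^{-ε})` and
`Ω' := {s : π(s) ≥ π0}`. If `n > n0`, then for every `T ⊆ Ω` both
`Pr(S_n ∈ T) ≤ e^ε Pr(S_{n-1} ∈ T) + δ` and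
`Pr(S_{n-1} ∈ T) ≤ e^ε Pr(S_n ∈ T) + δ`, where
`δ := max(Pr(S_n ∈ Ω'), Pr(S_{n-1} ∈ Ω'))`: the unmodified sketch is
`(ε, δ)`-differentially private.
-/

open MeasureTheory

attribute [local instance] Classical.propDecidable

theorem aux_erase {H : Type*} {m : ℕ} (i : Fin (m + 1)) (ω : Fin (m + 1) → H) :
    Aerase i ω = Afull (fun j => ω (i.succAbove j)) := by
  ext x
  simp only [Aerase, Afull, Finset.mem_image, Finset.mem_erase, Finset.mem_univ, and_true, true_and]
  constructor
  · rintro ⟨j, hj, rfl⟩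
    obtain ⟨k, rfl⟩ := Fin.exists_succAbove_eq hj
    exact ⟨k, rfl⟩
  · rintro ⟨k, rfl⟩
    exact ⟨_, Fin.succAbove_ne i k, rfl⟩

theorem aux_insert {H : Type*} {m : ℕ} (i : Fin (m + 1)) (ω : Fin (m + 1) → H) :
    Afull ω = insert (ω i) (Afull (fun j => ω (i.succAbove j))) := by
  rw [← aux_erase]
  ext x
  simp only [Aerase, Afull, Finset.mem_image, Finset.mem_erase, Finset.mem_univ, and_true,
    true_and, Finset.mem_insert]
  constructor
  · rintro ⟨j, rfl⟩
    by_cases h : j = i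
    · left; rw [h]
    · right; exact ⟨j, h, rfl⟩
  · rintro (rfl | ⟨j, _, rfl⟩)
    · exact ⟨_, rfl⟩
    · exact ⟨_, rfl⟩

instance aux_prob {H : Type*} [MeasurableSpace H] (μ : Measure H) [IsProbabilityMeasure μ] (m : ℕ) :
    IsProbabilityMeasure (streamP μ m) := by
  unfold streamP; infer_instance

theorem aux_transfer {H : Type*} [MeasurableSpace H] [MeasurableSingletonClass H] [Countable H]
    (μ : Measure H) [IsProbabilityMeasure μ] {m : ℕ} (i : Fin (m + 1))
    (s : Set (H × (Fin m → H))) :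
    streamP μ (m + 1) {ω | (ω i, fun j => ω (i.succAbove j)) ∈ s} = (μ.prod (streamP μ m)) s := by
  have h := measurePreserving_piFinSuccAbove (fun _ : Fin (m + 1) => μ) i
  exact h.measure_preimage (Set.to_countable s).measurableSet.nullMeasurableSet

theorem aux_marg {H : Type*} [MeasurableSpace H] [MeasurableSingletonClass H] [Countable H]
    (μ : Measure H) [IsProbabilityMeasure μ] {m : ℕ} (i : Fin (m + 1))
    (s : Set (Fin m → H)) :
    streamP μ (m + 1) {ω | (fun j => ω (i.succAbove j)) ∈ s} = streamP μ m s := by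
  have h := aux_transfer μ i (Set.univ ×ˢ s)
  rw [Measure.prod_prod, measure_univ, one_mul] at h
  rw [← h]
  simp

theorem aux_dir1 {H : Type*} [MeasurableSpace H] [MeasurableSingletonClass H] [Countable H]
    {Ω : Type*} (μ : Measure H) [IsProbabilityMeasure μ]
    (f : Finset H → Ω) (kmax m : ℕ)
    (hK : ∀ ω : Fin (m + 1) → H, (Kset f ω).card ≤ kmax) (T : Set Ω) :
    ((m + 1 : ℕ) : ENNReal) * streamP μ (m + 1) {ω | f (Afull ω) ∈ T} ≤
      ((m + 1 : ℕ) : ENNReal) * streamP μ m {ω | f (Afull ω) ∈ T} +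
        (kmax : ENNReal) * streamP μ (m + 1) {ω | f (Afull ω) ∈ T} := by
  set E : Set (Fin (m + 1) → H) := {ω | f (Afull ω) ∈ T} with hE
  let F : Fin (m + 1) → Set (Fin (m + 1) → H) :=
    fun i => {ω | f (Afull ω) ∈ T ∧ f (Aerase i ω) = f (Afull ω)}
  have hmeas : ∀ s : Set (Fin (m + 1) → H), MeasurableSet s := fun s => (Set.to_countable s).measurableSet
  have hF : ∀ i, streamP μ (m + 1) (F i) ≤ streamP μ m {ω | f (Afull ω) ∈ T} := by
    intro i
    rw [← aux_marg μ i]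
    apply measure_mono
    rintro ω ⟨h1, h2⟩
    simp only [Set.mem_ofPred_eq]
    rw [← aux_erase, h2]; exact h1
  have hpt : ∀ ω, ((m + 1 : ℕ) : ENNReal) * E.indicator 1 ω ≤
      (∑ i, (F i).indicator (1 : (Fin (m + 1) → H) → ENNReal) ω) + kmax * E.indicator 1 ω := by
    intro ω
    by_cases h : ω ∈ E
    · have h3 : ∀ i, (F i).indicator (1 : (Fin (m + 1) → H) → ENNReal) ω =
          if f (Aerase i ω) = f (Afull ω) then 1 else 0 := by
        intro i
        have : f (Afull ω) ∈ T := h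
        simp [F, Set.indicator_apply, this]
      simp only [h3, Set.indicator_of_mem h, Pi.one_apply, mul_one, Finset.sum_boole]
      have h4 := Finset.card_filter_add_card_filter_not (s := (Finset.univ : Finset (Fin (m+1))))
        (fun i => f (Aerase i ω) = f (Afull ω))
      have h5 := hK ω
      unfold Kset at h5
      simp only [Finset.card_univ, Fintype.card_fin] at h4
      norm_cast
      simp only [ne_eq] at h5
      omega
    · simp [Set.indicator_of_notMem h]
  have hint := lintegral_mono (μ := streamP μ (m + 1)) hpt
  rw [lintegral_const_mul _ (measurable_one.indicator (hmeas E)), lintegral_indicator_one (hmeas E),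
    lintegral_add_left (Finset.measurable_fun_sum _ fun i _ => measurable_one.indicator (hmeas _)),
    lintegral_finsetSum _ (fun i _ => measurable_one.indicator (hmeas _)),
    lintegral_const_mul _ (measurable_one.indicator (hmeas E)), lintegral_indicator_one (hmeas E)] at hint
  refine hint.trans ?_
  gcongr
  simp only [lintegral_indicator_one (hmeas _)]
  refine (Finset.sum_le_sum fun i _ => hF i).trans ?_
  simp

theorem aux_dir2 {H : Type*} [MeasurableSpace H] [MeasurableSingletonClass H] [Countable H]
    {Ω : Type*} (μ : Measure H) [IsProbabilityMeasure μ]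
    (f : Finset H → Ω) (π : Ω → ℝ)
    (hπ : ∀ A : Finset H, (μ {y | f (insert y A) ≠ f A}).toReal = π (f A))
    (m : ℕ) (c : ℝ) (T : Set Ω) (hT : ∀ t ∈ T, c ≤ 1 - π t) :
    ENNReal.ofReal c * streamP μ m {ω | f (Afull ω) ∈ T} ≤
      streamP μ (m + 1) {ω | f (Afull ω) ∈ T} := by
  let s : Set (H × (Fin m → H)) :=
    {p | f (Afull p.2) ∈ T ∧ f (insert p.1 (Afull p.2)) = f (Afull p.2)}
  have h1 : (μ.prod (streamP μ m)) s ≤ streamP μ (m + 1) {ω | f (Afull ω) ∈ T} := by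
    rw [← aux_transfer μ 0]
    apply measure_mono
    rintro ω ⟨h1, h2⟩
    simp only [Set.mem_ofPred_eq]
    rw [aux_insert 0 ω]
    simp only at h1 h2
    rw [h2]; exact h1
  refine le_trans ?_ h1
  rw [Measure.prod_apply_symm (Set.to_countable s).measurableSet]
  have hm : MeasurableSet {ω : Fin m → H | f (Afull ω) ∈ T} := (Set.to_countable _).measurableSet
  rw [← lintegral_indicator_const hm]
  apply lintegral_mono
  intro ω
  by_cases h : f (Afull ω) ∈ T
  · rw [Set.indicator_of_mem (by exact h)]
    have e : (fun x => (x, ω)) ⁻¹' s = {y | f (insert y (Afull ω)) ≠ f (Afull ω)}ᶜ := by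
      ext y; simp [s, h]
    simp only [e]
    apply ENNReal.ofReal_le_of_le_toReal
    have := probReal_compl_eq_one_sub (μ := μ)
      (Set.to_countable {y | f (insert y (Afull ω)) ≠ f (Afull ω)}).measurableSet
    simp only [Measure.real] at this
    rw [this, hπ]
    exact hT _ h
  · rw [Set.indicator_of_notMem (by exact h)]
    exact zero_le

theorem sketch_approx_dp
    {H : Type*} [MeasurableSpace H] [MeasurableSingletonClass H] [Countable H]
    {Ω : Type*} [Fintype Ω]
    (μ : Measure H) [IsProbabilityMeasure μ]
    (f : Finset H → Ω) (π : Ω → ℝ)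
    (hπ01 : ∀ t : Ω, π t ∈ Set.Icc (0 : ℝ) 1)
    (hπ : ∀ A : Finset H, (μ {y | f (insert y A) ≠ f A}).toReal = π (f A))
    (ε : ℝ) (hε : 0 < ε) (kmax : ℕ) (n : ℕ)
    (hK : ∀ ω : Fin n → H, (Kset f ω).card ≤ kmax)
    (hn : (kmax : ℝ) / (1 - Real.exp (-ε)) < (n : ℝ)) :
    ∀ T : Set Ω,
      ((streamP μ n) {ω | f (Afull ω) ∈ T}).toReal ≤
          Real.exp ε * ((streamP μ (n - 1)) {ω | f (Afull ω) ∈ T}).toReal +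
            max ((streamP μ n) {ω | 1 - Real.exp (-ε) ≤ π (f (Afull ω))}).toReal
              ((streamP μ (n - 1)) {ω | 1 - Real.exp (-ε) ≤ π (f (Afull ω))}).toReal ∧
        ((streamP μ (n - 1)) {ω | f (Afull ω) ∈ T}).toReal ≤
          Real.exp ε * ((streamP μ n) {ω | f (Afull ω) ∈ T}).toReal +
            max ((streamP μ n) {ω | 1 - Real.exp (-ε) ≤ π (f (Afull ω))}).toReal
              ((streamP μ (n - 1)) {ω | 1 - Real.exp (-ε) ≤ π (f (Afull ω))}).toReal := by
  intro T
  have he1 : Real.exp (-ε) < 1 := by rw [Real.exp_lt_one_iff]; linarith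
  have hep : 0 < Real.exp (-ε) := Real.exp_pos _
  have hee : Real.exp ε * Real.exp (-ε) = 1 := by rw [← Real.exp_add]; simp
  have hn0 : (0 : ℝ) < n := lt_of_le_of_lt (by apply div_nonneg <;> [positivity; linarith]) hn
  rw [div_lt_iff₀ (by linarith)] at hn
  obtain ⟨m, rfl⟩ : ∃ m, n = m + 1 := ⟨n - 1, by have : 0 < n := by exact_mod_cast hn0
                                                 omega⟩
  rw [Nat.add_sub_cancel]
  constructor
  · have h := ENNReal.toReal_mono (by finiteness) (aux_dir1 μ f kmax m hK T)
    rw [ENNReal.toReal_add (by finiteness) (by finiteness)] at h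
    simp only [ENNReal.toReal_mul, ENNReal.toReal_natCast] at h
    refine le_add_of_le_of_nonneg ?_ (le_max_of_le_left ENNReal.toReal_nonneg)
    set a := (streamP μ (m + 1) {ω | f (Afull ω) ∈ T}).toReal
    set b := (streamP μ m {ω | f (Afull ω) ∈ T}).toReal
    have ha : 0 ≤ a := ENNReal.toReal_nonneg
    have h1 : Real.exp (-ε) * a ≤ b := by
      refine le_of_mul_le_mul_left ?_ hn0
      nlinarith [mul_le_mul_of_nonneg_right hn.le ha]
    calc a = Real.exp ε * (Real.exp (-ε) * a) := by rw [← mul_assoc, hee, one_mul]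
      _ ≤ _ := by gcongr
  · have h := ENNReal.toReal_mono (by finiteness) (aux_dir2 μ f π hπ m (Real.exp (-ε))
      {t | t ∈ T ∧ ¬ (1 - Real.exp (-ε) ≤ π t)} (fun t ht => by have := ht.2; linarith))
    rw [ENNReal.toReal_mul, ENNReal.toReal_ofReal hep.le] at h
    have h2 : (streamP μ m {ω | f (Afull ω) ∈ T}).toReal ≤
        (streamP μ m {ω | f (Afull ω) ∈ {t | t ∈ T ∧ ¬ (1 - Real.exp (-ε) ≤ π t)}}).toReal +
        (streamP μ m {ω | 1 - Real.exp (-ε) ≤ π (f (Afull ω))}).toReal := by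
      rw [← ENNReal.toReal_add (by finiteness) (by finiteness)]
      refine ENNReal.toReal_mono (by finiteness) (le_trans (measure_mono ?_) (measure_union_le _ _))
      intro ω hω
      by_cases hc : 1 - Real.exp (-ε) ≤ π (f (Afull ω))
      · exact Or.inr hc
      · exact Or.inl ⟨hω, hc⟩
    have h3 : (streamP μ (m + 1)
        {ω | f (Afull ω) ∈ {t | t ∈ T ∧ ¬ (1 - Real.exp (-ε) ≤ π t)}}).toReal ≤
        (streamP μ (m + 1) {ω | f (Afull ω) ∈ T}).toReal :=
      ENNReal.toReal_mono (by finiteness) (measure_mono fun ω hω => hω.1)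
    refine h2.trans (add_le_add ?_ (le_max_right _ _))
    have h4 := mul_le_mul_of_nonneg_left (h.trans h3) (Real.exp_pos ε).le
    rwa [← mul_assoc, hee, one_mul] at h4
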